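/- arXiv:1805.12587 — 2 statements merged into one kernel-verified Lean document; each statement's English description precedes it below -/
import Mathlib

section
/- Let α ∈ (0,2] and let λ, μ, ν be complex numbers with λ ≠ 0 and ν ≠ 0. Set c_α = 2^{2 − max(1−2α,0) − 2·max(α−1,0)} · α^{α−1} · B(min(α,1), min(α,1)), ρ_* = (|μ| + √(|μ|² + c_α·|λ|·|ν|/Γ(α))) / (2^{1 − max(1−2α,0)} · α^{α}), and C_* = |ν| / (Γ(α+1)·ρ_*). Then the coefficients of the sequence solving (A_{λ,μ,ν}) satisfy |a_k| ≤ C_* · k^{α−1} · ρ_*^{k} for every integer k ≥ 1. -/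
open MeasureTheory Finset

/-- The Euler Beta function `B(a,b) = ∫₀¹ u^(a-1) (1-u)^(b-1) du`. -/
noncomputable def Beta (a b : ℝ) : ℝ :=
  ∫ u in Set.Ioo (0:ℝ) 1, u ^ (a - 1) * (1 - u) ^ (b - 1)

/-- The sequence `(a_k)` solving `(A_{λ,μ,ν})`. -/
def IsRiccatiSeq (α : ℝ) (l m n : ℂ) (a : ℕ → ℂ) : Prop :=
  a 0 = 0 ∧ a 1 = n / (Real.Gamma (α + 1) : ℂ) ∧
  ∀ k : ℕ, 1 ≤ k →
    a (k + 1) = (l * (∑ j ∈ Finset.Ico 1 k, a j * a (k - j)) + m * a k) *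
      ((Real.Gamma (α * (k:ℝ) + 1) / Real.Gamma (α * (k:ℝ) + α + 1) : ℝ) : ℂ)

/-- Wendel's inequality, at the argument shifted by one. -/
lemma Gamma_add_one_le_mul_rpow {x s : ℝ} (hx : 0 < x) (hs : 0 < s) (hs1 : s < 1) :
    Real.Gamma (x + 1) ≤ Real.Gamma (x + s) * (x + s) ^ (1 - s) := by
  have hxs : 0 < x + s := by positivity
  have hG : 0 < Real.Gamma (x + s) := Real.Gamma_pos_of_pos hxs
  have h := Real.Gamma_mul_add_mul_le_rpow_Gamma_mul_rpow_Gamma (s := x + s) (t := x + s + 1)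
    hxs (by positivity) hs (sub_pos.2 hs1) (by ring)
  rw [show s * (x + s) + (1 - s) * (x + s + 1) = x + 1 by ring, Real.Gamma_add_one hxs.ne',
    Real.mul_rpow hxs.le hG.le, mul_left_comm, ← Real.rpow_add hG, add_sub_cancel,
    Real.rpow_one] at h
  linarith

lemma Gamma_mul_rpow_le {x s : ℝ} (hx : 0 < x) (hs : 1 ≤ s) :
    Real.Gamma x * x ^ s ≤ Real.Gamma (x + s) := by
  have hs0 : 0 < s := by linarith
  rcases hs.eq_or_lt with rfl | hs1
  · rw [Real.Gamma_add_one hx.ne', Real.rpow_one, mul_comm]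
  have hG : 0 < Real.Gamma x := Real.Gamma_pos_of_pos hx
  have hG' : 0 < Real.Gamma (x + s) := Real.Gamma_pos_of_pos (by positivity)
  have h := Real.Gamma_mul_add_mul_le_rpow_Gamma_mul_rpow_Gamma (s := x) (t := x + s)
    (a := 1 - s⁻¹) (b := s⁻¹) hx (by positivity) (sub_pos.2 (inv_lt_one_of_one_lt₀ hs1))
    (by positivity) (by ring)
  rw [show (1 - s⁻¹) * x + s⁻¹ * (x + s) = x + 1 by field_simp; ring,
    Real.Gamma_add_one hx.ne'] at h
  have h2 := Real.rpow_le_rpow (by positivity) h hs0.le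
  rw [Real.mul_rpow hx.le hG.le, Real.mul_rpow (by positivity) (by positivity),
    ← Real.rpow_mul hG.le, ← Real.rpow_mul hG'.le, inv_mul_cancel₀ hs0.ne', Real.rpow_one,
    show (1 - s⁻¹) * s = s - 1 by field_simp, Real.rpow_sub_one hG.ne'] at h2
  have hGs : 0 < Real.Gamma x ^ s := by positivity
  have h3 : Real.Gamma x ^ s * (Real.Gamma x * x ^ s) ≤
      Real.Gamma x ^ s * Real.Gamma (x + s) := by
    calc _ = Real.Gamma x * (x ^ s * Real.Gamma x ^ s) := by ring
      _ ≤ Real.Gamma x * (Real.Gamma x ^ s / Real.Gamma x * Real.Gamma (x + s)) := by gcongr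
      _ = _ := by field_simp
  exact le_of_mul_le_mul_left h3 hGs

lemma rpow_bound_of_lt_half {α k : ℝ} (hα : 0 < α) (hα2 : α < 1 / 2) (hk : 1 ≤ k) :
    α ^ α * k ^ α * ((k + 1) / k) ^ (1 - α) * (α * k + 1 + α) ^ (1 - α) ≤
      2 ^ (1 - 2 * α) * (α * k + 1) := by
  have hk0 : 0 < k := by linarith
  have h1 : ((k + 1) / k) ^ (1 - α) ≤ 2 ^ (1 - 2 * α) * ((k + 1) / k) ^ α := by
    rw [show (1 - α) = (1 - 2 * α) + α by ring, Real.rpow_add (by positivity)]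
    gcongr
    · linarith
    · rw [div_le_iff₀ hk0]; linarith
  have h2 := Real.geom_mean_le_arith_mean2_weighted (p₁ := α * k + α) (p₂ := α * k + 1 + α)
    hα.le (by linarith : 0 ≤ 1 - α) (by positivity) (by positivity) (by ring)
  have h3 : α ^ α * k ^ α * ((k + 1) / k) ^ α = (α * k + α) ^ α := by
    rw [← Real.mul_rpow (by positivity) (by positivity),
      ← Real.mul_rpow (by positivity) (by positivity)]
    congr 1
    field_simp
  calc _ ≤ α ^ α * k ^ α * (2 ^ (1 - 2 * α) * ((k + 1) / k) ^ α) * (α * k + 1 + α) ^ (1 - α) := by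
        gcongr
    _ = 2 ^ (1 - 2 * α) * ((α ^ α * k ^ α * ((k + 1) / k) ^ α) * (α * k + 1 + α) ^ (1 - α)) := by
        ring
    _ ≤ _ := by
        rw [h3]
        gcongr
        nlinarith

lemma rpow_bound_of_half_le {α k : ℝ} (hα : 1 / 2 ≤ α) (hα1 : α < 1) (hk : 1 ≤ k) :
    α ^ α * k ^ α * ((k + 1) / k) ^ (1 - α) * (α * k + 1 + α) ^ (1 - α) ≤ α * k + 1 := by
  have hk0 : 0 < k := by linarith
  have hα0 : 0 < α := by linarith
  have h2 := Real.geom_mean_le_arith_mean3_weighted (p₁ := α * k) (p₂ := α * k + 1 + α)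
    (p₃ := α * k + α) (by linarith : 0 ≤ 2 * α - 1) (by linarith : 0 ≤ 1 - α)
    (by linarith : 0 ≤ 1 - α) (by positivity) (by positivity) (by positivity) (by ring)
  have h3 : α ^ α * k ^ α * ((k + 1) / k) ^ (1 - α) =
      (α * k) ^ (2 * α - 1) * (α * k + α) ^ (1 - α) := by
    rw [← Real.mul_rpow hα0.le hk0.le,
      show (α * k) ^ α = (α * k) ^ (2 * α - 1) * (α * k) ^ (1 - α) by
        rw [← Real.rpow_add (by positivity)]; congr 1; ring,
      mul_assoc, ← Real.mul_rpow (by positivity) (by positivity)]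
    congr 2
    field_simp
  rw [h3]
  nlinarith

lemma Gamma_ratio_le {α k : ℝ} (hα : 0 < α) (hk : 1 ≤ k) :
    Real.Gamma (α * k + 1) / Real.Gamma (α * k + α + 1) * (k ^ α * (k / (k + 1)) ^ (α - 1)) ≤
      2 ^ max (1 - 2 * α) 0 / α ^ α := by
  have hk0 : 0 < k := by linarith
  have hx : 0 < α * k + 1 := by positivity
  have hG : 0 < Real.Gamma (α * k + 1) := Real.Gamma_pos_of_pos hx
  have hG' : 0 < Real.Gamma (α * k + α + 1) := Real.Gamma_pos_of_pos (by positivity)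
  suffices h : Real.Gamma (α * k + 1) * (α ^ α * k ^ α * (k / (k + 1)) ^ (α - 1)) ≤
      2 ^ max (1 - 2 * α) 0 * Real.Gamma (α * k + α + 1) by
    rw [div_mul_eq_mul_div, div_le_div_iff₀ hG' (by positivity)]
    linarith
  rcases le_or_gt 1 α with h1 | h1
  · rw [max_eq_right (by linarith), Real.rpow_zero, one_mul]
    have h2 := Gamma_mul_rpow_le hx h1
    rw [show α * k + 1 + α = α * k + α + 1 by ring] at h2
    refine le_trans ?_ h2
    rw [← Real.mul_rpow hα.le hk0.le]
    gcongr
    have h3 : (k / (k + 1)) ^ (α - 1) ≤ 1 :=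
      Real.rpow_le_one (by positivity) (by rw [div_le_one (by positivity)]; linarith)
        (by linarith)
    have h4 : (α * k) ^ α ≤ (α * k + 1) ^ α := by gcongr; linarith
    calc _ ≤ (α * k) ^ α * 1 := by gcongr
      _ ≤ _ := by linarith
  · have h2 := Gamma_add_one_le_mul_rpow hx hα h1
    rw [Real.Gamma_add_one hx.ne'] at h2
    have h3 : α ^ α * k ^ α * ((k + 1) / k) ^ (1 - α) * (α * k + 1 + α) ^ (1 - α) ≤
        2 ^ max (1 - 2 * α) 0 * (α * k + 1) := by
      rcases lt_or_ge α (1 / 2) with h4 | h4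
      · rw [max_eq_left (by linarith)]
        exact rpow_bound_of_lt_half hα h4 hk
      · rw [max_eq_right (by linarith), Real.rpow_zero, one_mul]
        exact rpow_bound_of_half_le h4 h1 hk
    have h5 : (k / (k + 1)) ^ (α - 1) = ((k + 1) / k) ^ (1 - α) := by
      rw [← neg_sub 1 α, Real.rpow_neg (by positivity), ← Real.inv_rpow (by positivity), inv_div]
    rw [h5, show α * k + α + 1 = α * k + 1 + α by ring]
    have hp : 0 < (α * k + 1 + α) ^ (1 - α) := by positivity
    refine le_of_mul_le_mul_right ?_ hp
    calc _ = Real.Gamma (α * k + 1) *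
          (α ^ α * k ^ α * ((k + 1) / k) ^ (1 - α) * (α * k + 1 + α) ^ (1 - α)) := by ring
      _ ≤ Real.Gamma (α * k + 1) * (2 ^ max (1 - 2 * α) 0 * (α * k + 1)) := by gcongr
      _ = 2 ^ max (1 - 2 * α) 0 * ((α * k + 1) * Real.Gamma (α * k + 1)) := by ring
      _ ≤ 2 ^ max (1 - 2 * α) 0 *
          (Real.Gamma (α * k + 1 + α) * (α * k + 1 + α) ^ (1 - α)) := by gcongr
      _ = _ := by ring

lemma integrableOn_Beta {a b : ℝ} (ha : 0 < a) (hb : 0 < b) :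
    IntegrableOn (fun u : ℝ => u ^ (a - 1) * (1 - u) ^ (b - 1)) (Set.Ioo 0 1) := by
  have h := (Complex.betaIntegral_convergent (u := a) (v := b) (by simpa) (by simpa))
  rw [intervalIntegrable_iff_integrableOn_Ioo_of_le zero_le_one] at h
  refine IntegrableOn.congr_fun h.re (fun x hx => ?_) measurableSet_Ioo
  have h1 : (0:ℝ) ≤ 1 - x := by linarith [hx.2]
  have e1 : ((x : ℂ)) ^ ((a : ℂ) - 1) = ((x ^ (a - 1) : ℝ) : ℂ) := by
    rw [Complex.ofReal_cpow hx.1.le]; push_cast; rfl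
  have e2 : (1 - (x : ℂ)) ^ ((b : ℂ) - 1) = (((1 - x) ^ (b - 1) : ℝ) : ℂ) := by
    rw [Complex.ofReal_cpow h1]; push_cast; rfl
  simp only [e1, e2, ← Complex.ofReal_mul]
  exact Complex.ofReal_re _

lemma Beta_one_one : Beta 1 1 = 1 := by
  simp [Beta]

/-- The Riemann sum with each interior node replaced by the adjacent cell towards the nearer
endpoint is bounded by the Beta integral. -/
lemma sum_rpow_mul_rpow_le_Beta {α : ℝ} (hα : 0 < α) (hα1 : α ≤ 1) {k : ℕ} (hk : 1 ≤ k) :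
    ∑ j ∈ Finset.Ico 1 k, (j : ℝ) ^ (α - 1) * ((k - j : ℕ) : ℝ) ^ (α - 1) ≤
      Beta α α * (k : ℝ) ^ (2 * α - 1) := by
  have hk0 : (0:ℝ) < k := by exact_mod_cast hk
  set f : ℝ → ℝ := fun u => u ^ (α - 1) * (1 - u) ^ (α - 1) with hf
  have hint : IntegrableOn f (Set.Ioo 0 1) := integrableOn_Beta hα hα
  set c : ℕ → ℕ := fun j => if 2 * j ≤ k then j - 1 else j with hc
  set I : ℕ → Set ℝ := fun j => Set.Ioo ((c j : ℝ) / k) ((c j + 1 : ℝ) / k) with hI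
  have hsub : ∀ j ∈ Finset.Ico 1 k, I j ⊆ Set.Ioo 0 1 := by
    intro j hj
    rw [Finset.mem_Ico] at hj
    refine Set.Ioo_subset_Ioo (by positivity) ?_
    rw [div_le_one hk0]
    have : c j + 1 ≤ k := by simp only [hc]; split_ifs <;> omega
    exact_mod_cast this
  have hdisj : Set.Pairwise (↑(Finset.Ico 1 k)) (Function.onFun Disjoint I) := by
    intro i hi j hj hij
    rw [Finset.mem_coe, Finset.mem_Ico] at hi hj
    have hne : c i ≠ c j := by simp only [hc]; split_ifs <;> omega
    have key : ∀ p q : ℕ, p < q → Disjoint (Set.Ioo ((p : ℝ) / k) ((p + 1 : ℝ) / k))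
        (Set.Ioo ((q : ℝ) / k) ((q + 1 : ℝ) / k)) := by
      intro p q hpq
      rw [Set.disjoint_left]
      intro x hx hx'
      have h1 : ((p : ℝ) + 1) / k ≤ q / k := by
        gcongr
        exact_mod_cast hpq
      linarith [hx.2, hx'.1]
    rcases lt_or_gt_of_ne hne with h | h
    · exact key _ _ h
    · exact (key _ _ h).symm
  have hcell : ∀ j ∈ Finset.Ico 1 k, f ((j : ℝ) / k) * (1 / k) ≤ ∫ x in I j, f x := by
    intro j hj
    have hj' := Finset.mem_Ico.1 hj
    have hvol : volume.real (I j) = 1 / k := by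
      rw [hI, Real.volume_real_Ioo_of_le (by gcongr; linarith)]
      field_simp
      ring
    rw [← hvol]
    refine setIntegral_ge_of_const_le_real measurableSet_Ioo (by simp [hI]) ?_
      (hint.mono_set (hsub j hj))
    intro x hx
    have hx01 := hsub j hj hx
    have hx1 : 0 < 1 - x := by linarith [hx01.2]
    have hj0 : (0:ℝ) < j := by exact_mod_cast hj'.1
    have hjk : (j:ℝ) < k := by exact_mod_cast hj'.2
    have ht1 : 0 < 1 - (j:ℝ) / k := by rw [sub_pos, div_lt_one hk0]; exact hjk
    have ht0 : 0 < (j:ℝ) / k := by positivity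
    simp only [hf]
    rw [← Real.mul_rpow hx01.1.le hx1.le, ← Real.mul_rpow ht0.le ht1.le]
    refine Real.rpow_le_rpow_of_nonpos (mul_pos hx01.1 hx1) ?_ (by linarith)
    have hfac : ((j:ℝ) / k) * (1 - (j:ℝ) / k) - x * (1 - x) =
      ((j:ℝ) / k - x) * (1 - (j:ℝ) / k - x) := by ring
    suffices 0 ≤ ((j:ℝ) / k - x) * (1 - (j:ℝ) / k - x) by linarith
    by_cases h2 : 2 * j ≤ k
    · have hcj : (c j : ℝ) + 1 = j := by
        have : c j + 1 = j := by simp only [hc, if_pos h2]; omega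
        exact_mod_cast this
      have h3 : x < (j:ℝ) / k := by have := hx.2; rwa [hcj] at this
      have h4 : (j:ℝ) / k ≤ 1 - (j:ℝ) / k := by
        have : (2:ℝ) * j ≤ k := by exact_mod_cast h2
        rw [le_sub_iff_add_le, ← add_div, div_le_one hk0]
        linarith
      exact mul_nonneg (by linarith) (by linarith)
    · have hcj : (c j : ℝ) = j := by simp only [hc, if_neg h2]
      have h3 : (j:ℝ) / k < x := by have := hx.1; rwa [hcj] at this
      have h4 : 1 - (j:ℝ) / k ≤ (j:ℝ) / k := by
        have : (k:ℝ) ≤ 2 * j := by exact_mod_cast (not_le.1 h2).le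
        rw [sub_le_iff_le_add, ← add_div, le_div_iff₀ hk0]
        linarith
      exact mul_nonneg_of_nonpos_of_nonpos (by linarith) (by linarith)
  have hsum : ∑ j ∈ Finset.Ico 1 k, f ((j : ℝ) / k) * (1 / k) ≤ Beta α α := by
    calc _ ≤ ∑ j ∈ Finset.Ico 1 k, ∫ x in I j, f x := Finset.sum_le_sum hcell
      _ = ∫ x in ⋃ j ∈ Finset.Ico 1 k, I j, f x :=
          (integral_biUnion_finset _ (fun _ _ => measurableSet_Ioo) hdisj
            (fun j hj => hint.mono_set (hsub j hj))).symm
      _ ≤ ∫ x in Set.Ioo 0 1, f x := by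
          refine setIntegral_mono_set hint ?_ (Set.iUnion₂_subset hsub).eventuallyLE
          filter_upwards [ae_restrict_mem measurableSet_Ioo] with x hx
          have h1 := hx.1.le
          have h2 : 0 ≤ 1 - x := by linarith [hx.2]
          simp only [hf, Pi.zero_apply]
          positivity
      _ = _ := rfl
  calc _ = (∑ j ∈ Finset.Ico 1 k, f ((j : ℝ) / k) * (1 / k)) * (k : ℝ) ^ (2 * α - 1) := by
        rw [Finset.sum_mul]
        refine Finset.sum_congr rfl fun j hj => ?_
        have hj' := Finset.mem_Ico.1 hj
        have hkj : (0:ℝ) ≤ (k:ℝ) - j := by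
          rw [sub_nonneg]; exact_mod_cast hj'.2.le
        rw [Nat.cast_sub hj'.2.le]
        simp only [hf]
        rw [show 1 - (j:ℝ) / k = ((k:ℝ) - j) / k by field_simp,
          Real.div_rpow (by positivity) hk0.le, Real.div_rpow hkj hk0.le,
          show 2 * α - 1 = (α - 1) + (α - 1) + 1 by ring, Real.rpow_add_one hk0.ne',
          Real.rpow_add hk0]
        field_simp
    _ ≤ _ := by gcongr

lemma sum_rpow_mul_rpow_le {α : ℝ} (hα : 0 < α) {k : ℕ} (hk : 1 ≤ k) :
    ∑ j ∈ Finset.Ico 1 k, (j : ℝ) ^ (α - 1) * ((k - j : ℕ) : ℝ) ^ (α - 1) ≤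
      (2:ℝ) ^ (-(2 * max (α - 1) 0)) * Beta (min α 1) (min α 1) * (k : ℝ) ^ (2 * α - 1) := by
  rcases le_total α 1 with h1 | h1
  · rw [max_eq_right (by linarith), min_eq_left h1]
    simpa using sum_rpow_mul_rpow_le_Beta hα h1 hk
  · rw [max_eq_left (by linarith), min_eq_right h1, Beta_one_one, mul_one]
    have hk0 : (0:ℝ) < k := by exact_mod_cast hk
    have hterm : ∀ j ∈ Finset.Ico 1 k, (j : ℝ) ^ (α - 1) * ((k - j : ℕ) : ℝ) ^ (α - 1) ≤
        ((k / 2 : ℝ) ^ (2:ℝ)) ^ (α - 1) := by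
      intro j hj
      have hj' := Finset.mem_Ico.1 hj
      rw [← Real.mul_rpow (by positivity) (by positivity), Nat.cast_sub hj'.2.le]
      have hkj : (0:ℝ) ≤ (k:ℝ) - j := by
        rw [sub_nonneg]; exact_mod_cast hj'.2.le
      refine Real.rpow_le_rpow (by positivity) ?_ (by linarith)
      rw [Real.rpow_two]
      nlinarith [sq_nonneg ((j:ℝ) - k / 2)]
    refine (Finset.sum_le_card_nsmul _ _ _ hterm).trans ?_
    rw [Nat.card_Ico, nsmul_eq_mul, ← Real.rpow_mul (by positivity),
      Real.div_rpow hk0.le (by norm_num), show 2 * α - 1 = 2 * (α - 1) + 1 by ring,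
      Real.rpow_add_one hk0.ne', Real.rpow_neg (by norm_num)]
    have : ((k - 1 : ℕ) : ℝ) ≤ k := by exact_mod_cast Nat.sub_le k 1
    calc _ ≤ (k:ℝ) * ((k:ℝ) ^ (2 * (α - 1)) / 2 ^ (2 * (α - 1))) := by gcongr
      _ = _ := by field_simp

lemma Beta_pos_of_le_one {α : ℝ} (hα : 0 < α) (hα1 : α ≤ 1) : 0 < Beta α α := by
  have h := sum_rpow_mul_rpow_le_Beta hα hα1 (k := 2) (by norm_num)
  have h0 : (0:ℝ) < ((2:ℕ):ℝ) ^ (2 * α - 1) := by positivity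
  simp at h
  by_contra! hB
  have : Beta α α * 2 ^ (2 * α - 1) ≤ 0 := mul_nonpos_of_nonpos_of_nonneg hB (by positivity)
  linarith

theorem stmt_1 (α : ℝ) (hα : 0 < α) (hα2 : α ≤ 2)
    (lam mu nu : ℂ) (hlam : lam ≠ 0) (hnu : nu ≠ 0)
    (a : ℕ → ℂ) (ha : IsRiccatiSeq α lam mu nu a)
    (cα ρ C : ℝ)
    (hc : cα = (2:ℝ) ^ (2 - max (1 - 2*α) 0 - 2 * max (α - 1) 0) * α ^ (α - 1) *
      Beta (min α 1) (min α 1))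
    (hρ : ρ = (‖mu‖ + Real.sqrt (‖mu‖^2 + cα * ‖lam‖ * ‖nu‖ / Real.Gamma α)) /
      ((2:ℝ) ^ (1 - max (1 - 2*α) 0) * α ^ α))
    (hC : C = ‖nu‖ / (Real.Gamma (α + 1) * ρ)) :
    ∀ k : ℕ, 1 ≤ k → ‖a k‖ ≤ C * (k:ℝ) ^ (α - 1) * ρ ^ k := by
  have hΓ : 0 < Real.Gamma α := Real.Gamma_pos_of_pos hα
  have hΓ1 : 0 < Real.Gamma (α + 1) := Real.Gamma_pos_of_pos (by linarith)
  have hΓe : Real.Gamma (α + 1) = α * Real.Gamma α := Real.Gamma_add_one hα.ne'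
  have hl : 0 < ‖lam‖ := norm_pos_iff.2 hlam
  have hn : 0 < ‖nu‖ := norm_pos_iff.2 hnu
  have hB : 0 < Beta (min α 1) (min α 1) :=
    Beta_pos_of_le_one (lt_min hα one_pos) (min_le_right _ _)
  obtain ⟨b, hb⟩ : ∃ b, b = (2:ℝ) ^ (-(2 * max (α - 1) 0)) * Beta (min α 1) (min α 1) :=
    ⟨_, rfl⟩
  obtain ⟨M, hM⟩ : ∃ M, M = (2:ℝ) ^ max (1 - 2 * α) 0 := ⟨_, rfl⟩
  obtain ⟨A, hA⟩ : ∃ A, A = α ^ α := ⟨_, rfl⟩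
  have hb0 : 0 < b := by rw [hb]; positivity
  have hM0 : 0 < M := by rw [hM]; positivity
  have hA0 : 0 < A := by rw [hA]; positivity
  have hc' : cα = 4 * b * A / (M * α) := by
    rw [hc, sub_eq_add_neg, Real.rpow_add two_pos, Real.rpow_sub two_pos, ← hM,
      Real.rpow_sub_one hα.ne', ← hA, hb, Real.rpow_two]
    field_simp
    norm_num
  have hc0 : 0 < cα := by rw [hc']; positivity
  have hρ' : ρ = (‖mu‖ + Real.sqrt (‖mu‖^2 + cα * ‖lam‖ * ‖nu‖ / Real.Gamma α)) /
      (2 / M * A) := by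
    rw [hρ, Real.rpow_sub two_pos, Real.rpow_one, ← hM, ← hA]
  have hrad : 0 < ‖mu‖^2 + cα * ‖lam‖ * ‖nu‖ / Real.Gamma α := by positivity
  have hρ0 : 0 < ρ := by
    rw [hρ']
    have := Real.sqrt_pos.2 hrad
    positivity
  have hquad : ‖lam‖ * C * (M / A * b) + ‖mu‖ * (M / A) = ρ := by
    have hs : Real.sqrt (‖mu‖^2 + cα * ‖lam‖ * ‖nu‖ / Real.Gamma α) =
        ρ * (2 / M * A) - ‖mu‖ := by
      rw [hρ']; field_simp; ring
    have hq := Real.sq_sqrt hrad.le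
    rw [hs, hc'] at hq
    rw [hC, hΓe]
    field_simp at hq ⊢
    nlinarith
  have hC0 : 0 < C := by rw [hC]; positivity
  obtain ⟨-, ha1, hrec⟩ := ha
  intro k
  induction k using Nat.strong_induction_on with
  | _ n ih =>
  intro hn1
  rcases hn1.eq_or_lt with rfl | hn2
  · rw [ha1, hC, norm_div, Complex.norm_real, Real.norm_of_nonneg hΓ1.le]
    simp
    field_simp
    exact le_rfl
  obtain ⟨k, rfl⟩ : ∃ k, n = k + 1 := ⟨n - 1, by omega⟩
  have hk : 1 ≤ k := by omega
  have hk1 : (1:ℝ) ≤ k := by exact_mod_cast hk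
  have hk0 : (0:ℝ) < k := by linarith
  obtain ⟨G, hG⟩ : ∃ G, G = Real.Gamma (α * (k:ℝ) + 1) / Real.Gamma (α * (k:ℝ) + α + 1) :=
    ⟨_, rfl⟩
  have hG0 : 0 < G := by
    rw [hG]
    exact div_pos (Real.Gamma_pos_of_pos (by positivity)) (Real.Gamma_pos_of_pos (by positivity))
  have hratio := Gamma_ratio_le hα hk1
  rw [← hG, ← hM, ← hA, Real.div_rpow hk0.le (by positivity)] at hratio
  have hS := sum_rpow_mul_rpow_le hα hk
  rw [← hb] at hS
  set S := ∑ j ∈ Finset.Ico 1 k, (j : ℝ) ^ (α - 1) * ((k - j : ℕ) : ℝ) ^ (α - 1) with hSdef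
  have hK : 0 < ((k:ℝ) + 1) ^ (α - 1) := by positivity
  have hconv : ‖∑ j ∈ Finset.Ico 1 k, a j * a (k - j)‖ ≤ C ^ 2 * ρ ^ k * S := by
    rw [hSdef, Finset.mul_sum]
    refine norm_sum_le_of_le _ fun j hj => ?_
    have hj' := Finset.mem_Ico.1 hj
    rw [norm_mul]
    calc _ ≤ (C * (j:ℝ) ^ (α - 1) * ρ ^ j) *
          (C * ((k - j : ℕ):ℝ) ^ (α - 1) * ρ ^ (k - j)) := by
          gcongr
          · exact ih j (by omega) hj'.1
          · exact ih (k - j) (by omega) (by omega)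
      _ = _ := by
          rw [← Nat.add_sub_of_le hj'.2.le, pow_add, Nat.add_sub_of_le hj'.2.le]
          ring
  have h2 : G * (k:ℝ) ^ (2 * α - 1) ≤ M / A * ((k:ℝ) + 1) ^ (α - 1) := by
    rw [← div_le_iff₀ hK]
    refine le_of_eq_of_le ?_ hratio
    rw [show 2 * α - 1 = α + (α - 1) by ring, Real.rpow_add hk0]
    ring
  have h1 : G * (k:ℝ) ^ (α - 1) ≤ M / A * ((k:ℝ) + 1) ^ (α - 1) := by
    refine le_trans ?_ h2
    gcongr ?_ * ?_
    exact Real.rpow_le_rpow_of_exponent_le hk1 (by linarith)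
  rw [hrec k hk, ← hG, norm_mul, Complex.norm_real, Real.norm_of_nonneg hG0.le]
  push_cast
  calc _ ≤ (‖lam‖ * (C ^ 2 * ρ ^ k * (b * (k:ℝ) ^ (2 * α - 1))) +
        ‖mu‖ * (C * (k:ℝ) ^ (α - 1) * ρ ^ k)) * G := by
        gcongr
        refine (norm_add_le _ _).trans ?_
        rw [norm_mul, norm_mul]
        gcongr
        · exact hconv.trans (by gcongr)
        · exact ih k (by omega) hk
    _ = C * ρ ^ k * (‖lam‖ * C * b * (G * (k:ℝ) ^ (2 * α - 1)) +
        ‖mu‖ * (G * (k:ℝ) ^ (α - 1))) := by ring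
    _ ≤ C * ρ ^ k * (‖lam‖ * C * b * (M / A * ((k:ℝ) + 1) ^ (α - 1)) +
        ‖mu‖ * (M / A * ((k:ℝ) + 1) ^ (α - 1))) := by gcongr
    _ = C * ((k:ℝ) + 1) ^ (α - 1) * ρ ^ k *
        (‖lam‖ * C * (M / A * b) + ‖mu‖ * (M / A)) := by ring
    _ = _ := by rw [hquad]; ring
end

section
/- Let α ∈ (0,1] and let λ > 0 and ν > 0 be real numbers. With ρ = (5^{1−α}/3)·α^{−α}·λν/Γ(α+1) and c = ν/(Γ(α+1)·ρ), the sequence (b_k)_{k≥1} satisfies b_k ≥ c·ρ^{k}·k^{α−1} for every integer k ≥ 1. -/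
open Finset

/-- The sequence `(b_k)` of odd-index coefficients of the fractional power series solving
the fractional Riccati equation with `μ = 0`:
`b 1 = ν/Γ(α+1)` and `b (k+1) = λ Γ(2αk+1)/Γ((2k+1)α+1) ∑_{j=1}^k b_j b_{k+1-j}`. -/
def IsOddRiccatiSeq (α : ℝ) (l n : ℝ) (b : ℕ → ℝ) : Prop :=
  b 1 = n / Real.Gamma (α + 1) ∧
  ∀ k : ℕ, 1 ≤ k →
    b (k + 1) = l * (Real.Gamma (2 * α * (k:ℝ) + 1) / Real.Gamma ((2 * (k:ℝ) + 1) * α + 1)) *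
      ∑ j ∈ Finset.Icc 1 k, b j * b (k + 1 - j)

open Filter Topology

/-- Up to an affine function of `x`, the difference between the values of
`x log x + log Γ(2x) - log Γ(3x)` at `x` and at `x + 1`. -/
noncomputable def gammaRatioStep (x : ℝ) : ℝ :=
  x * Real.log x - (x + 1) * Real.log (x + 1) + Real.log (3 * x + 1) + Real.log (3 * x + 2)
    - Real.log (2 * x + 1)

lemma gammaRatioStep_deriv2_nonneg {x : ℝ} (hx : 0 < x) :
    0 ≤ 1 / x - 1 / (x + 1) - 9 / (3 * x + 1) ^ 2 - 9 / (3 * x + 2) ^ 2 + 4 / (2 * x + 1) ^ 2 := by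
  have key : 1 / x - 1 / (x + 1) - 9 / (3 * x + 1) ^ 2 - 9 / (3 * x + 2) ^ 2
      + 4 / (2 * x + 1) ^ 2
      = (27 * (2 * x + 1) ^ 4 + 38 * (2 * x + 1) ^ 2 - 1) /
        (16 * x * (x + 1) * (3 * x + 1) ^ 2 * (3 * x + 2) ^ 2 * (2 * x + 1) ^ 2) := by
    field_simp
    ring
  rw [key]
  have h1 : 1 ≤ (2 * x + 1) ^ 2 := by nlinarith
  have h2 : 0 ≤ 27 * (2 * x + 1) ^ 4 := by positivity
  exact div_nonneg (by linarith) (by positivity)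

lemma convexOn_gammaRatioStep : ConvexOn ℝ (Set.Ioi 0) gammaRatioStep := by
  have hlin : ∀ a b x : ℝ, HasDerivAt (fun y : ℝ => a * y + b) a x := fun a b x => by
    simpa using ((hasDerivAt_id x).const_mul a).add_const b
  have hd : ∀ x : ℝ, 0 < x → HasDerivAt gammaRatioStep
      (Real.log x - Real.log (x + 1) + 3 / (3 * x + 1) + 3 / (3 * x + 2) - 2 / (2 * x + 1)) x := by
    intro x hx
    have hs := (hasDerivAt_id x).add_const (1 : ℝ)
    have h := ((((hasDerivAt_id x).mul (Real.hasDerivAt_log hx.ne')).sub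
      (hs.mul (hs.log (by simp; positivity)))).add
      ((hlin 3 1 x).log (by positivity))).add ((hlin 3 2 x).log (by positivity)) |>.sub
      ((hlin 2 1 x).log (by positivity))
    refine h.congr_deriv ?_
    simp only [id]
    field_simp
    ring
  have hd' : ∀ x : ℝ, 0 < x → HasDerivAt (fun x : ℝ =>
      Real.log x - Real.log (x + 1) + 3 / (3 * x + 1) + 3 / (3 * x + 2) - 2 / (2 * x + 1))
      (1 / x - 1 / (x + 1) - 9 / (3 * x + 1) ^ 2 - 9 / (3 * x + 2) ^ 2 + 4 / (2 * x + 1) ^ 2) x := by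
    intro x hx
    have h := ((((Real.hasDerivAt_log hx.ne').sub
      (((hasDerivAt_id x).add_const (1 : ℝ)).log (by simp; positivity))).add
      ((hasDerivAt_const x (3 : ℝ)).div (hlin 3 1 x) (by positivity))).add
      ((hasDerivAt_const x (3 : ℝ)).div (hlin 3 2 x) (by positivity))).sub
      ((hasDerivAt_const x (2 : ℝ)).div (hlin 2 1 x) (by positivity))
    refine h.congr_deriv ?_
    simp only [id]
    ring
  refine convexOn_of_hasDerivWithinAt2_nonneg (convex_Ioi 0)
    (fun x hx => (hd x hx).continuousAt.continuousWithinAt)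
    (fun x hx => (hd x (by simpa using hx)).hasDerivWithinAt)
    (fun x hx => (hd' x (by simpa using hx)).hasDerivWithinAt)
    (fun x hx => gammaRatioStep_deriv2_nonneg (by simpa using hx))

lemma mul_log_add_sum_log_eq (N : ℕ) {x : ℝ} (hx : 0 < x) :
    x * Real.log x + ∑ m ∈ range (3 * N), Real.log (3 * x + (m + 1 : ℕ))
      - ∑ m ∈ range (2 * N), Real.log (2 * x + (m + 1 : ℕ))
    = ∑ n ∈ range N, gammaRatioStep (x + n) + (x + N) * Real.log (x + N)
      + N * Real.log (3 / 2) := by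
  induction N with
  | zero => simp
  | succ N ih =>
    have h3 : Real.log (3 * x + (3 * N + 3)) = Real.log 3 + Real.log (x + N + 1) := by
      rw [← Real.log_mul (by norm_num) (by positivity)]; ring_nf
    have h2 : Real.log (2 * x + (2 * N + 2)) = Real.log 2 + Real.log (x + N + 1) := by
      rw [← Real.log_mul (by norm_num) (by positivity)]; ring_nf
    have h32 : Real.log (3 / 2) = Real.log 3 - Real.log 2 :=
      Real.log_div (by norm_num) (by norm_num)
    rw [show 3 * (N + 1) = 3 * N + 1 + 1 + 1 by ring, show 2 * (N + 1) = 2 * N + 1 + 1 by ring]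
    simp only [sum_range_succ]
    push_cast at ih ⊢
    rw [show 3 * x + (3 * (N : ℝ) + 2 + 1) = 3 * x + (3 * N + 3) by ring,
      show 2 * x + (2 * (N : ℝ) + 1 + 1) = 2 * x + (2 * N + 2) by ring, h3, h2,
      show x + ((N : ℝ) + 1) = x + N + 1 by ring]
    have e : gammaRatioStep (x + N) = (x + N) * Real.log (x + N)
        - (x + N + 1) * Real.log (x + N + 1) + Real.log (3 * x + (3 * N + 1))
        + Real.log (3 * x + (3 * N + 1 + 1)) - Real.log (2 * x + (2 * N + 1)) := by
      unfold gammaRatioStep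
      ring_nf
    rw [e]
    linarith

/-- `N`-th approximant of `x log x + log Γ(2x) - log Γ(3x)` given by Euler's limit formula. -/
noncomputable def gammaRatioSeq (N : ℕ) (x : ℝ) : ℝ :=
  x * Real.log x + Real.BohrMollerup.logGammaSeq (2 * x) (2 * N)
    - Real.BohrMollerup.logGammaSeq (3 * x) (3 * N)

lemma convexOn_gammaRatioSeq (N : ℕ) : ConvexOn ℝ (Set.Ioi 0) (gammaRatioSeq N) := by
  have haff : ∀ A B : ℝ, ConvexOn ℝ (Set.Ioi 0) (fun x : ℝ => A * x + B) := fun A B =>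
    ⟨convex_Ioi 0, fun x _ y _ a b _ _ hab => by
      simp only [smul_eq_mul]
      exact le_of_eq (by linear_combination -B * hab)⟩
  have htrans : ∀ (f : ℝ → ℝ) (n : ℕ), ConvexOn ℝ (Set.Ioi 0) f →
      ConvexOn ℝ (Set.Ioi 0) (fun x => f (x + n)) := fun f n hf =>
    (hf.translate_left (n : ℝ)).subset
      (fun x (hx : 0 < x) => show 0 < (n : ℝ) + x by positivity) (convex_Ioi 0)
  have hsum : ConvexOn ℝ (Set.Ioi 0) (fun x : ℝ => ∑ n ∈ range N, gammaRatioStep (x + n)) := by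
    induction N with
    | zero => simpa using haff 0 0
    | succ N ih =>
      simp only [sum_range_succ]
      exact ih.add (htrans _ N convexOn_gammaRatioStep)
  have hlog := htrans _ N (Real.convexOn_mul_log.subset Set.Ioi_subset_Ici_self (convex_Ioi 0))
  refine ((hsum.add hlog).add (haff (2 * Real.log (2 * N : ℕ) - 3 * Real.log (3 * N : ℕ))
    (Real.log (2 * N).factorial - Real.log (3 * N).factorial
      + (N + 1) * Real.log (3 / 2)))).congr ?_
  intro x hx
  have hx : 0 < x := hx
  have h := mul_log_add_sum_log_eq N hx
  have h32 : Real.log (3 / 2) = Real.log (3 * x) - Real.log (2 * x) := by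
    rw [← Real.log_div (by positivity) (by positivity)]
    congr 1
    field_simp
  simp only [Pi.add_apply, gammaRatioSeq, Real.BohrMollerup.logGammaSeq,
    sum_range_succ' _ (2 * N), sum_range_succ' _ (3 * N), Nat.cast_zero, add_zero]
  linear_combination -h + h32

lemma convexOn_mul_log_add_log_Gamma_sub_log_Gamma : ConvexOn ℝ (Set.Ioi 0) (fun x : ℝ =>
    x * Real.log x + Real.log (Real.Gamma (2 * x)) - Real.log (Real.Gamma (3 * x))) := by
  have hlim : ∀ x : ℝ, 0 < x → Tendsto (fun N => gammaRatioSeq N x) atTop (𝓝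
      (x * Real.log x + Real.log (Real.Gamma (2 * x)) - Real.log (Real.Gamma (3 * x)))) := by
    intro x hx
    have hmul : ∀ c : ℕ, 0 < c → Tendsto (fun N : ℕ => c * N) atTop atTop := fun c hc =>
      tendsto_id.const_mul_atTop' hc
    exact (((Real.BohrMollerup.tendsto_log_gamma (by positivity)).comp
      (hmul 2 two_pos)).const_add _).sub
      ((Real.BohrMollerup.tendsto_log_gamma (by positivity)).comp (hmul 3 three_pos))
  refine ⟨convex_Ioi 0, fun x hx y hy a b ha hb hab => ?_⟩
  exact le_of_tendsto_of_tendsto' (hlim _ (convex_Ioi 0 hx hy ha hb hab))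
    (((hlim x hx).const_smul a).add ((hlim y hy).const_smul b))
    (fun N => (convexOn_gammaRatioSeq N).2 hx hy ha hb hab)

lemma rpow_le_rpow_mul_Gamma_div_Gamma {α : ℝ} (hα : 0 < α) (hα1 : α ≤ 1) :
    (2 : ℝ) ^ (α - 1) ≤ 3 * α ^ α * 5 ^ (α - 1) *
      (Real.Gamma (2 * α + 1) / Real.Gamma (3 * α + 1)) := by
  have h2 : 0 < Real.Gamma (2 * α) := Real.Gamma_pos_of_pos (by positivity)
  have h3 : 0 < Real.Gamma (3 * α) := Real.Gamma_pos_of_pos (by positivity)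
  have hα2 : 0 < 2 - α := by linarith
  have hc := convexOn_mul_log_add_log_Gamma_sub_log_Gamma.2 (Set.mem_Ioi.2 hα)
    (Set.mem_Ioi.2 (two_pos : (0 : ℝ) < 2)) (by positivity : 0 ≤ 1 / (2 - α))
    (div_nonneg (by linarith) hα2.le : 0 ≤ (1 - α) / (2 - α)) (by field_simp; ring)
  have h1 : (1 / (2 - α)) • α + ((1 - α) / (2 - α)) • (2 : ℝ) = 1 := by
    simp only [smul_eq_mul]
    field_simp
    ring
  have g : ∀ n : ℕ, Real.Gamma ((n : ℝ) + 1) = n.factorial := Real.Gamma_nat_eq_factorial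
  have g3 : Real.Gamma 3 = 2 := by
    rw [show (3 : ℝ) = (2 : ℕ) + 1 by norm_num, g]; norm_num [Nat.factorial]
  have g4 : Real.Gamma 4 = 6 := by
    rw [show (4 : ℝ) = (3 : ℕ) + 1 by norm_num, g]; norm_num [Nat.factorial]
  have g6 : Real.Gamma 6 = 120 := by
    rw [show (6 : ℝ) = (5 : ℕ) + 1 by norm_num, g]; norm_num [Nat.factorial]
  rw [h1] at hc
  norm_num [g3, g4, g6] at hc
  have l120 : Real.log 120 = 2 * Real.log 2 + Real.log 6 + Real.log 5 := by
    rw [show (120 : ℝ) = 2 ^ 2 * 6 * 5 by norm_num, Real.log_mul (by norm_num) (by norm_num),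
      Real.log_mul (by norm_num) (by norm_num), Real.log_pow]
    norm_num
  rw [l120] at hc
  have hc' : -((2 - α) * Real.log 2) + (1 - α) * Real.log 5 ≤
      α * Real.log α + Real.log (Real.Gamma (2 * α)) - Real.log (Real.Gamma (3 * α)) := by
    have h := mul_le_mul_of_nonneg_left hc hα2.le
    field_simp at h
    rw [mul_comm α 3] at h
    linarith
  rw [Real.Gamma_add_one (by positivity), Real.Gamma_add_one (by positivity)]
  rw [show 3 * α ^ α * 5 ^ (α - 1) * (2 * α * Real.Gamma (2 * α) / (3 * α * Real.Gamma (3 * α)))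
    = 2 * α ^ α * 5 ^ (α - 1) * Real.Gamma (2 * α) / Real.Gamma (3 * α) by field_simp]
  rw [← Real.log_le_log_iff (by positivity) (by positivity),
    Real.log_div (by positivity) (by positivity), Real.log_mul (by positivity) (by positivity),
    Real.log_mul (by positivity) (by positivity), Real.log_mul (by positivity) (by positivity),
    Real.log_rpow hα, Real.log_rpow two_pos, Real.log_rpow (by norm_num)]
  linarith

lemma Gamma_add_le_rpow_mul_Gamma {x α : ℝ} (hx : 0 < x) (hα : 0 < α) (hα1 : α ≤ 1) :
    Real.Gamma (x + α) ≤ x ^ α * Real.Gamma x := by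
  have hG := Real.Gamma_pos_of_pos hx
  rcases hα1.eq_or_lt with rfl | h1
  · rw [Real.Gamma_add_one hx.ne', Real.rpow_one]
  · have h := Real.Gamma_mul_add_mul_le_rpow_Gamma_mul_rpow_Gamma hx (by positivity : 0 < x + 1)
      (sub_pos.2 h1) hα (by ring)
    rw [show (1 - α) * x + α * (x + 1) = x + α by ring, Real.Gamma_add_one hx.ne',
      Real.mul_rpow hx.le hG.le] at h
    calc _ ≤ _ := h
      _ = x ^ α * (Real.Gamma x ^ (1 - α) * Real.Gamma x ^ α) := by ring
      _ = _ := by rw [← Real.rpow_add hG, sub_add_cancel, Real.rpow_one]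

lemma one_add_mul_sub_one_le_rpow {x p : ℝ} (hx : 0 < x) (hp : p ≤ 0) :
    1 + p * (x - 1) ≤ x ^ p := by
  rw [Real.rpow_def_of_pos hx]
  have h1 := Real.add_one_le_exp (Real.log x * p)
  have h2 := mul_le_mul_of_nonpos_right (Real.log_le_sub_one_of_pos hx) hp
  linarith

lemma card_mul_rpow_le_sum_rpow {ι : Type*} (s : Finset ι) (f : ι → ℝ) {m p : ℝ}
    (hm : 0 < m) (hp : p ≤ 0) (hf : ∀ i ∈ s, 0 < f i) (hs : ∑ i ∈ s, f i = #s * m) :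
    #s * m ^ p ≤ ∑ i ∈ s, f i ^ p := by
  have h : ∀ i ∈ s, m ^ p * (1 + p * (f i / m - 1)) ≤ f i ^ p := by
    intro i hi
    have := mul_le_mul_of_nonneg_left
      (one_add_mul_sub_one_le_rpow (div_pos (hf i hi) hm) hp) (Real.rpow_nonneg hm.le p)
    rwa [← Real.mul_rpow hm.le (div_pos (hf i hi) hm).le, mul_div_cancel₀ _ hm.ne'] at this
  refine le_trans (le_of_eq ?_) (sum_le_sum h)
  rw [← mul_sum, sum_add_distrib, ← mul_sum, sum_sub_distrib, ← sum_div, hs]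
  simp only [sum_const, nsmul_eq_mul, mul_one]
  field_simp
  ring

lemma sum_Icc_mul_reflect (k : ℕ) :
    ∑ j ∈ Icc 1 k, (j : ℝ) * ((k : ℝ) + 1 - j) = k * ((k + 1) * (k + 2) / 6) := by
  have h : ∀ (n : ℕ) (a : ℝ), ∑ j ∈ Icc 1 n, (j : ℝ) * (a - j)
      = a * (n * (n + 1) / 2) - n * (n + 1) * (2 * n + 1) / 6 := by
    intro n a
    induction n with
    | zero => simp
    | succ n ih =>
      rw [sum_Icc_succ_top (by omega), ih]
      push_cast
      ring
  rw [h]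
  ring

lemma rpow_le_convolution_rpow {α : ℝ} (hα : 0 < α) (hα1 : α ≤ 1) {k : ℕ} (hk : 1 ≤ k) :
    ((k : ℝ) + 1) ^ (α - 1) ≤ 3 * α ^ α * 5 ^ (α - 1) *
      (Real.Gamma (2 * α * k + 1) / Real.Gamma ((2 * k + 1) * α + 1)) *
      ∑ j ∈ Icc 1 k, ((j : ℝ) * ((k : ℝ) + 1 - j)) ^ (α - 1) := by
  rcases hk.eq_or_lt with rfl | hk2
  · have h := rpow_le_rpow_mul_Gamma_div_Gamma hα hα1
    norm_num at h ⊢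
    exact h
  have hk2 : (2 : ℝ) ≤ k := by exact_mod_cast hk2
  have hk0 : (0 : ℝ) < k := by linarith
  have hsum := card_mul_rpow_le_sum_rpow (Icc 1 k) (fun j => (j : ℝ) * ((k : ℝ) + 1 - j))
    (m := (k + 1) * (k + 2) / 6) (p := α - 1) (by positivity) (by linarith)
    (fun j hj => by
      obtain ⟨h1, h2⟩ := mem_Icc.1 hj
      have h1 : (1 : ℝ) ≤ j := by exact_mod_cast h1
      have h2 : (j : ℝ) ≤ k := by exact_mod_cast h2
      exact mul_pos (by linarith) (by linarith))
    (by simpa using sum_Icc_mul_reflect k)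
  rw [Nat.card_Icc, Nat.add_sub_cancel] at hsum
  set x : ℝ := 2 * α * k + 1 with hx
  have hx0 : 0 < x := by positivity
  have hG := Real.Gamma_pos_of_pos hx0
  have hG' : 0 < Real.Gamma (x + α) := Real.Gamma_pos_of_pos (by positivity)
  have hR : (x ^ α)⁻¹ ≤ Real.Gamma x / Real.Gamma (x + α) := by
    rw [inv_eq_one_div, div_le_div_iff₀ (by positivity) hG', one_mul, mul_comm]
    exact Gamma_add_le_rpow_mul_Gamma hx0 hα hα1
  rw [show (2 * (k : ℝ) + 1) * α + 1 = x + α by rw [hx]; ring]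
  have hAG : (x / α) ^ α * (5 * (k + 2) / 6) ^ (1 - α) ≤ 3 * k := by
    refine (Real.geom_mean_le_arith_mean2_weighted hα.le (sub_nonneg.2 hα1) (by positivity)
      (by positivity) (by ring)).trans ?_
    rw [mul_div_cancel₀ _ hα.ne', hx]
    nlinarith
  have hmain : ((k : ℝ) + 1) ^ (α - 1) ≤ 3 * α ^ α * 5 ^ (α - 1) * (x ^ α)⁻¹ *
      (k * ((k + 1) * (k + 2) / 6) ^ (α - 1)) := by
    have e : 3 * α ^ α * 5 ^ (α - 1) * (x ^ α)⁻¹ * (k * (((k : ℝ) + 1) * (k + 2) / 6) ^ (α - 1))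
        = ((k : ℝ) + 1) ^ (α - 1) *
          (3 * k / ((x / α) ^ α * (5 * (k + 2) / 6) ^ (1 - α))) := by
      rw [show (1 - α) = -(α - 1) by ring, Real.rpow_neg (by positivity),
        show ((k : ℝ) + 1) * (k + 2) / 6 = (k + 1) * ((k + 2) / 6) by ring,
        show 5 * ((k : ℝ) + 2) / 6 = 5 * ((k + 2) / 6) by ring,
        Real.mul_rpow (by positivity) (by positivity),
        Real.mul_rpow (by positivity) (by positivity), Real.div_rpow hx0.le hα.le]
      field_simp
    rw [e]
    refine le_mul_of_one_le_right (by positivity) ?_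
    rwa [le_div_iff₀ (by positivity), one_mul]
  calc _ ≤ _ := hmain
    _ ≤ _ := by gcongr

theorem stmt_14 (α : ℝ) (hα : 0 < α) (hα1 : α ≤ 1)
    (lam nu : ℝ) (hlam : 0 < lam) (hnu : 0 < nu)
    (b : ℕ → ℝ) (hb : IsOddRiccatiSeq α lam nu b)
    (ρ c : ℝ)
    (hρ : ρ = ((5:ℝ) ^ (1 - α) / 3) * α ^ (-α) * (lam * nu) / Real.Gamma (α + 1))
    (hc : c = nu / (Real.Gamma (α + 1) * ρ)) :
    ∀ k : ℕ, 1 ≤ k → c * ρ ^ k * (k:ℝ) ^ (α - 1) ≤ b k := by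
  obtain ⟨hb1, hbs⟩ := hb
  have hG : 0 < Real.Gamma (α + 1) := Real.Gamma_pos_of_pos (by positivity)
  have hρ0 : 0 < ρ := by rw [hρ]; positivity
  have hc0 : 0 < c := by rw [hc]; positivity
  have hlc : lam * c = 3 * α ^ α * 5 ^ (α - 1) := by
    rw [hc, hρ, Real.rpow_neg hα.le, show α - 1 = -(1 - α) by ring, Real.rpow_neg (by norm_num)]
    field_simp
  intro k
  induction k using Nat.strong_induction_on with
  | _ k ih =>
    intro hk
    rcases hk.eq_or_lt with rfl | hk2
    · rw [hb1, hc]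
      simp only [Nat.cast_one, Real.one_rpow, pow_one, mul_one]
      exact le_of_eq (by field_simp)
    obtain ⟨k, rfl⟩ : ∃ n, k = n + 1 := ⟨k - 1, by omega⟩
    have hk1 : 1 ≤ k := by omega
    rw [hbs k hk1]
    have hR : 0 < Real.Gamma (2 * α * k + 1) / Real.Gamma ((2 * k + 1) * α + 1) :=
      div_pos (Real.Gamma_pos_of_pos (by positivity)) (Real.Gamma_pos_of_pos (by positivity))
    have hsum : c ^ 2 * ρ ^ (k + 1) * ∑ j ∈ Icc 1 k, ((j : ℝ) * ((k : ℝ) + 1 - j)) ^ (α - 1)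
        ≤ ∑ j ∈ Icc 1 k, b j * b (k + 1 - j) := by
      rw [mul_sum]
      refine sum_le_sum fun j hj => ?_
      obtain ⟨h1, h2⟩ := mem_Icc.1 hj
      have hj' := ih j (by omega) h1
      have hj'' := ih (k + 1 - j) (by omega) (by omega)
      have hcast : ((k + 1 - j : ℕ) : ℝ) = (k : ℝ) + 1 - j := by
        rw [Nat.cast_sub (by omega)]; push_cast; ring
      have hpow : ρ ^ (k + 1) = ρ ^ j * ρ ^ (k + 1 - j) := by
        rw [← pow_add]; congr 1; omega
      rw [← hcast, Real.mul_rpow (by positivity) (by positivity), hpow]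
      calc _ = (c * ρ ^ j * (j : ℝ) ^ (α - 1)) *
            (c * ρ ^ (k + 1 - j) * ((k + 1 - j : ℕ) : ℝ) ^ (α - 1)) := by ring
        _ ≤ _ := mul_le_mul hj' hj'' (by positivity) (le_trans (by positivity) hj')
    refine le_trans ?_ (mul_le_mul_of_nonneg_left hsum (by positivity))
    have h := mul_le_mul_of_nonneg_left (rpow_le_convolution_rpow hα hα1 hk1)
      (by positivity : 0 ≤ c * ρ ^ (k + 1))
    rw [← hlc] at h
    push_cast
    refine h.trans (le_of_eq (by ring))
end
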